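/- arXiv:math/9811077 — 10 statements merged into one kernel-verified Lean document; each statement's English description precedes it below -/
import Mathlib

section
/- Let pt = 4·arctan(√2/5) − π/3, m = 0.3621, b = 0.49246, ε = 0.0739626, b_c = 0.253095. Let sc₁,…,sc₁₅, sol₁,…,sol₁₅ and dih₁,…,dih₁₀ be real numbers satisfying: (i) scᵢ + m·solᵢ + ε·(dihᵢ − 2π/5) ≤ b_c for i = 1,…,10; (ii) scⱼ + m·solⱼ ≤ b for j = 11,…,15; (iii) dih₁ + ⋯ + dih₅ = 2π and dih₆ + ⋯ + dih₁₀ = 2π; (iv) sol₁ + ⋯ + sol₁₅ = 4π. Then sc₁ + ⋯ + sc₁₅ ≤ 5b + 10b_c − 4πm, and this bound is less than 8·pt. -/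
open Real Finset

/-- A Taylor lower bound for the arctangent, of degree eleven. -/
theorem arctan_taylor_lower_bound {x : ℝ} (hx : 0 ≤ x) :
    x - x ^ 3 / 3 + x ^ 5 / 5 - x ^ 7 / 7 + x ^ 9 / 9 - x ^ 11 / 11 ≤ arctan x := by
  let f : ℝ → ℝ := fun t =>
    arctan t - (t - t ^ 3 / 3 + t ^ 5 / 5 - t ^ 7 / 7 + t ^ 9 / 9 - t ^ 11 / 11)
  have hf (t : ℝ) : HasDerivAt f (t ^ 12 / (1 + t ^ 2)) t := by
    have hp (n : ℕ) := (hasDerivAt_pow n t).div_const (n : ℝ)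
    refine ((hasDerivAt_arctan t).sub
      ((((((hasDerivAt_id t).sub (hp 3)).add (hp 5)).sub (hp 7)).add (hp 9)).sub
        (hp 11))).congr_deriv ?_
    have : 1 + t ^ 2 ≠ 0 := by positivity
    push_cast
    field_simp
    ring
  have hmono : Monotone f :=
    monotone_of_hasDerivAt_nonneg hf fun t => by positivity
  have h := hmono hx
  simp only [f, arctan_zero] at h
  linarith

theorem pentahedral_prism_score_bound
    (sc sol dih : ℕ → ℝ)
    (h_tet : ∀ i ∈ Finset.Icc 1 10,
      sc i + 0.3621 * sol i + 0.0739626 * (dih i - 2 * π / 5) ≤ 0.253095)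
    (h_quad : ∀ j ∈ Finset.Icc 11 15, sc j + 0.3621 * sol j ≤ 0.49246)
    (h_dih1 : ∑ i ∈ Finset.Icc 1 5, dih i = 2 * π)
    (h_dih2 : ∑ i ∈ Finset.Icc 6 10, dih i = 2 * π)
    (h_sol : ∑ i ∈ Finset.Icc 1 15, sol i = 4 * π) :
    (∑ i ∈ Finset.Icc 1 15, sc i ≤ 5 * 0.49246 + 10 * 0.253095 - 4 * π * 0.3621) ∧
    5 * (0.49246 : ℝ) + 10 * 0.253095 - 4 * π * 0.3621
      < 8 * (4 * arctan (Real.sqrt 2 / 5) - π / 3) := by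
  constructor
  · have split {a b c : ℕ} (hab : a ≤ b + 1) (hbc : b ≤ c) (g : ℕ → ℝ) :
        ∑ i ∈ Icc a c, g i = ∑ i ∈ Icc a b, g i + ∑ i ∈ Icc (b + 1) c, g i := by
      simp only [← Finset.Ico_add_one_right_eq_Icc]
      exact (Finset.sum_Ico_consecutive g hab (by lia)).symm
    have ht := Finset.sum_le_sum h_tet
    have hq := Finset.sum_le_sum h_quad
    have hd := split (a := 1) (b := 5) (c := 10) (by simp) (by simp) dih
    have hs := split (a := 1) (b := 10) (c := 15) (by simp) (by simp) sol
    have hc := split (a := 1) (b := 10) (c := 15) (by simp) (by simp) sc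
    simp only [Finset.sum_add_distrib, ← Finset.mul_sum, Finset.sum_sub_distrib,
      Finset.sum_const, Nat.card_Icc, nsmul_eq_mul] at ht hq
    norm_num at ht hq hd hs hc
    linarith
  · have hπ := pi_lt_d6
    have hs : (1.414213 : ℝ) < √2 := Real.lt_sqrt_of_sq_lt (by norm_num)
    have h := arctan_taylor_lower_bound (x := √2 / 5) (by positivity)
    have h2 : (√2 / 5) ^ 2 = 2 / 25 := by
      rw [div_pow, Real.sq_sqrt (by norm_num)]
      norm_num
    have hpoly (x : ℝ) : x - x ^ 3 / 3 + x ^ 5 / 5 - x ^ 7 / 7 + x ^ 9 / 9 - x ^ 11 / 11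
        = x * (1 - x ^ 2 / 3 + (x ^ 2) ^ 2 / 5 - (x ^ 2) ^ 3 / 7 + (x ^ 2) ^ 4 / 9
          - (x ^ 2) ^ 5 / 11) := by
      ring
    rw [hpoly, h2] at h
    norm_num at h
    linarith
end

section
/- Let pt = 4·arctan(√2/5) − π/3, c = 0.1533667634670977 and d = 0.2265. Suppose sc₁, sc₂, sc₃, sc₄ and dih₁, dih₂, dih₃, dih₄ are real numbers with scᵢ + c·dihᵢ ≤ d for i = 1,2,3,4 and dih₁ + dih₂ + dih₃ + dih₄ = 2π. Then sc₁ + sc₂ + sc₃ + sc₄ ≤ 4d − 2πc, and moreover 4d − 2πc < −1.04·pt. -/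
open Real

/-- The degree-nine Taylor polynomial of `arctan` bounds it from above on the nonnegative reals. -/
theorem arctan_le_taylor_nine {x : ℝ} (hx : 0 ≤ x) :
    arctan x ≤ x - x ^ 3 / 3 + x ^ 5 / 5 - x ^ 7 / 7 + x ^ 9 / 9 := by
  have hderiv (t : ℝ) :
      HasDerivAt (fun t : ℝ => t - t ^ 3 / 3 + t ^ 5 / 5 - t ^ 7 / 7 + t ^ 9 / 9 - arctan t)
        (t ^ 10 / (1 + t ^ 2)) t := by
    have hne : 1 + t ^ 2 ≠ 0 := by positivity
    refine ((((((hasDerivAt_id t).sub ((hasDerivAt_pow 3 t).div_const 3)).add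
      ((hasDerivAt_pow 5 t).div_const 5)).sub ((hasDerivAt_pow 7 t).div_const 7)).add
      ((hasDerivAt_pow 9 t).div_const 9)).sub (hasDerivAt_arctan t)).congr_deriv ?_
    push_cast
    field_simp
    ring
  have hmono := monotone_of_hasDerivAt_nonneg hderiv fun t => by
    simp only [Pi.zero_apply]
    positivity
  have h := hmono hx
  norm_num at h
  linarith

theorem octahedron_short_diagonal_elimination
    (sc₁ sc₂ sc₃ sc₄ dih₁ dih₂ dih₃ dih₄ : ℝ)
    (h₁ : sc₁ + 0.1533667634670977 * dih₁ ≤ 0.2265)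
    (h₂ : sc₂ + 0.1533667634670977 * dih₂ ≤ 0.2265)
    (h₃ : sc₃ + 0.1533667634670977 * dih₃ ≤ 0.2265)
    (h₄ : sc₄ + 0.1533667634670977 * dih₄ ≤ 0.2265)
    (hdih : dih₁ + dih₂ + dih₃ + dih₄ = 2 * π) :
    sc₁ + sc₂ + sc₃ + sc₄ ≤ 4 * 0.2265 - 2 * π * 0.1533667634670977 ∧
    4 * (0.2265 : ℝ) - 2 * π * 0.1533667634670977
      < -1.04 * (4 * arctan (Real.sqrt 2 / 5) - π / 3) := by
  refine ⟨by linarith, ?_⟩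
  have hmono : arctan (√2 / 5) ≤ arctan 0.282843 := by
    refine arctan_mono ?_
    have : √2 ≤ 1.414215 := Real.sqrt_le_iff.mpr (by norm_num)
    linarith
  have htaylor := hmono.trans (arctan_le_taylor_nine (by norm_num))
  linarith [pi_gt_d20, pi_lt_d20]
end

section
/- In a Euclidean space, a triangle whose side lengths are 2.2, 2.2 and 2.716 has circumradius strictly less than √2. -/
open Real

/-- The circumradius of a triangle in terms of its side lengths, in a form without division. -/
theorem sq_dist_eq_circumradius_sq_mul
    {V P : Type*} [NormedAddCommGroup V] [InnerProductSpace ℝ V]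
    [MetricSpace P] [NormedAddTorsor V P]
    (T : Affine.Simplex ℝ P 2) :
    (dist (T.points 0) (T.points 1) * dist (T.points 0) (T.points 2) *
        dist (T.points 1) (T.points 2)) ^ 2 =
      T.circumradius ^ 2 *
        (4 * dist (T.points 0) (T.points 2) ^ 2 * dist (T.points 1) (T.points 2) ^ 2 -
          (dist (T.points 0) (T.points 2) ^ 2 + dist (T.points 1) (T.points 2) ^ 2 -
            dist (T.points 0) (T.points 1) ^ 2) ^ 2) := by
  set φ := EuclideanGeometry.angle (T.points 0) (T.points 2) (T.points 1) with hφ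
  have hlaw : dist (T.points 0) (T.points 1) / Real.sin φ = 2 * T.circumradius :=
    Affine.Triangle.dist_div_sin_angle_eq_two_mul_circumradius T
      (by decide) (by decide) (by decide)
  have hne : Real.sin φ ≠ 0 := by
    intro h
    rw [h, div_zero] at hlaw
    linarith [T.circumradius_pos]
  have hsin := (div_eq_iff hne).mp hlaw
  have hcos := EuclideanGeometry.law_cos (T.points 0) (T.points 2) (T.points 1)
  rw [← hφ] at hcos
  have hdiff : dist (T.points 0) (T.points 2) ^ 2 + dist (T.points 1) (T.points 2) ^ 2 -
      dist (T.points 0) (T.points 1) ^ 2 =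
        2 * dist (T.points 0) (T.points 2) * dist (T.points 1) (T.points 2) * Real.cos φ := by
    linarith
  rw [hdiff, hsin, mul_pow, mul_pow, mul_pow _ (Real.sin φ), Real.sin_sq]
  ring

theorem circumradius_face_lt_sqrt_two
    {V P : Type*} [NormedAddCommGroup V] [InnerProductSpace ℝ V]
    [MetricSpace P] [NormedAddTorsor V P]
    (T : Affine.Simplex ℝ P 2)
    (h01 : dist (T.points 0) (T.points 1) = 2.2)
    (h02 : dist (T.points 0) (T.points 2) = 2.2)
    (h12 : dist (T.points 1) (T.points 2) = 2.716) :
    T.circumradius < Real.sqrt 2 := by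
  have h := sq_dist_eq_circumradius_sq_mul T
  rw [h01, h02, h12] at h
  refine Real.lt_sqrt_of_sq_lt ?_
  norm_num at h
  linarith
end

section
/- Fix y with 0 ≤ y, and let t ∈ (4/2.51, 2.51) satisfy y < r(t) where r(t) = √((16 − 2t²)/(16 − t²)). Define, for τ near t, s(τ) = τ/√(16 − τ²), u(τ) = √((2 − y²)/(1 + s(τ)²)), and A(τ, y) = (1/2)·(s(τ)·u(τ) − s(τ))·(u(τ) − 1) + ∫_{s(τ)·u(τ)}^{√(1−y²)} (√(2 − x² − y²) − 1) dx. Then the derivative of τ ↦ A(τ, y) at τ = t equals 8/(16 − t²)^{3/2} − (2 − y²)/(2·√(16 − t²)). -/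
open Real intervalIntegral

/-- `s` parameter of the Rogers simplex attached to a face `(2, 2, t)`. -/
noncomputable def quoinS (t : ℝ) : ℝ := t / Real.sqrt (16 - t ^ 2)

/-- Width of the quoin attached to a face `(2, 2, t)`. -/
noncomputable def quoinR (t : ℝ) : ℝ := Real.sqrt ((16 - 2 * t ^ 2) / (16 - t ^ 2))

/-- `u` parameter of the slice of the quoin at height `y`. -/
noncomputable def quoinU (t y : ℝ) : ℝ := Real.sqrt ((2 - y ^ 2) / (1 + quoinS t ^ 2))

/-- Area of the slice of the quoin at height `y`. -/
noncomputable def quoinA (t y : ℝ) : ℝ :=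
  (1 / 2) * (quoinS t * quoinU t y - quoinS t) * (quoinU t y - 1) +
    ∫ x in (quoinS t * quoinU t y)..(Real.sqrt (1 - y ^ 2)),
      (Real.sqrt (2 - x ^ 2 - y ^ 2) - 1)

lemma quoinU_eq {t : ℝ} (ht : 0 < 16 - t ^ 2) (y : ℝ) :
    quoinU t y = √(16 - t ^ 2) / 4 * √(2 - y ^ 2) := by
  have hs : 1 + quoinS t ^ 2 = 16 / (16 - t ^ 2) := by
    rw [quoinS, div_pow, Real.sq_sqrt ht.le]
    field_simp
    ring
  have h : (2 - y ^ 2) / (16 / (16 - t ^ 2)) = (√(16 - t ^ 2) / 4) ^ 2 * (2 - y ^ 2) := by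
    rw [div_pow, Real.sq_sqrt ht.le]
    field_simp
    norm_num
  rw [quoinU, hs, h, Real.sqrt_mul (sq_nonneg _), Real.sqrt_sq (by positivity)]

lemma quoinS_mul_quoinU {t : ℝ} (ht : 0 < 16 - t ^ 2) (y : ℝ) :
    quoinS t * quoinU t y = t / 4 * √(2 - y ^ 2) := by
  have hw : √(16 - t ^ 2) ≠ 0 := (Real.sqrt_pos.2 ht).ne'
  rw [quoinU_eq ht, quoinS]
  field_simp

lemma quoinR_le_one {t : ℝ} (ht : 0 < 16 - t ^ 2) : quoinR t ≤ 1 := by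
  rw [quoinR, Real.sqrt_le_one, div_le_one ht]
  nlinarith [sq_nonneg t]

theorem quoin_slice_area_deriv
    (y t : ℝ) (hy : 0 ≤ y) (ht : t ∈ Set.Ioo (4 / 2.51) 2.51) (hyr : y < quoinR t) :
    HasDerivAt (fun τ => quoinA τ y)
      (8 / (16 - t ^ 2) ^ ((3 : ℝ) / 2) - (2 - y ^ 2) / (2 * Real.sqrt (16 - t ^ 2))) t := by
  have ht0 : 0 < t := lt_trans (by norm_num) ht.1
  have hpos : 0 < 16 - t ^ 2 := by nlinarith [ht.2]
  have hy2 : 0 ≤ 2 - y ^ 2 := by nlinarith [hyr.trans_le (quoinR_le_one hpos)]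
  have hev : (fun τ => quoinA τ y) =ᶠ[nhds t] fun τ =>
      (1 / 2) * (τ / 4 * √(2 - y ^ 2) - τ / √(16 - τ ^ 2)) *
        (√(16 - τ ^ 2) / 4 * √(2 - y ^ 2) - 1) +
      ∫ x in (τ / 4 * √(2 - y ^ 2))..√(1 - y ^ 2), (√(2 - x ^ 2 - y ^ 2) - 1) := by
    have hc : ContinuousAt (fun τ : ℝ => 16 - τ ^ 2) t := by fun_prop
    filter_upwards [hc.eventually (lt_mem_nhds hpos)] with τ hτ
    rw [quoinA, quoinS_mul_quoinU hτ, quoinU_eq hτ, quoinS]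
  refine HasDerivAt.congr_of_eventuallyEq ?_ hev
  have hcont : Continuous fun x : ℝ => √(2 - x ^ 2 - y ^ 2) - 1 := by fun_prop
  have hint : HasDerivAt (fun a => ∫ x in a..√(1 - y ^ 2), (√(2 - x ^ 2 - y ^ 2) - 1))
      (-(√(2 - (t / 4 * √(2 - y ^ 2)) ^ 2 - y ^ 2) - 1)) (t / 4 * √(2 - y ^ 2)) :=
    intervalIntegral.integral_hasDerivAt_left (hcont.intervalIntegrable _ _)
      (hcont.stronglyMeasurableAtFilter _ _) hcont.continuousAt
  have hend : √(2 - (t / 4 * √(2 - y ^ 2)) ^ 2 - y ^ 2) = √(16 - t ^ 2) / 4 * √(2 - y ^ 2) := by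
    rw [← Real.sqrt_sq (by positivity : 0 ≤ √(16 - t ^ 2) / 4 * √(2 - y ^ 2))]
    congr 1
    rw [mul_pow, mul_pow, div_pow √_, Real.sq_sqrt hpos.le, Real.sq_sqrt hy2]
    ring
  rw [hend] at hint
  have hsu : HasDerivAt (fun τ : ℝ => τ / 4 * √(2 - y ^ 2)) (1 / 4 * √(2 - y ^ 2)) t :=
    ((hasDerivAt_id t).div_const 4).mul_const _
  have hw : HasDerivAt (fun τ : ℝ => √(16 - τ ^ 2)) (-(2 * t) / (2 * √(16 - t ^ 2))) t := by
    have h : HasDerivAt (fun τ : ℝ => 16 - τ ^ 2) (-(2 * t)) t := by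
      simpa using (hasDerivAt_pow 2 t).const_sub 16
    exact h.sqrt hpos.ne'
  have hw0 : 0 < √(16 - t ^ 2) := Real.sqrt_pos.2 hpos
  have hs := (hasDerivAt_id t).div hw hw0.ne'
  have hu := (hw.div_const 4).mul_const √(2 - y ^ 2)
  have hpow : (16 - t ^ 2) ^ ((3 : ℝ) / 2) = √(16 - t ^ 2) ^ 3 := by
    rw [Real.sqrt_eq_rpow, ← Real.rpow_mul_natCast hpos.le]
    norm_num
  have H := (((hsu.sub hs).const_mul (1 / 2)).mul (hu.sub_const 1)).add (hint.comp t hsu)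
  refine H.congr_deriv ?_
  have hq := Real.sq_sqrt hy2
  have hw2 := Real.sq_sqrt hpos.le
  rw [hpow]
  simp only [id, Pi.sub_apply, Pi.div_apply]
  generalize √(2 - y ^ 2) = q at *
  rw [← hq]
  generalize √(16 - t ^ 2) = w at *
  have ht2 : t ^ 2 = 16 - w ^ 2 := by linarith
  field_simp
  ring_nf
  rw [ht2]
  ring
end

section
/- For t ∈ (4/2.51, 2.51), define r(t) = √((16 − 2t²)/(16 − t²)), s(t) = t/√(16 − t²), u(t, y) = √((2 − y²)/(1 + s(t)²)), A(t, y) = (1/2)·(s(t)·u(t,y) − s(t))·(u(t,y) − 1) + ∫_{s(t)·u(t,y)}^{√(1−y²)} (√(2 − x² − y²) − 1) dx, and the quoin volume V(t) = ∫₀^{r(t)} A(t, y) dy. Then V is differentiable on (4/2.51, 2.51) with V′(t) = −2√2·(8 − t²)^{3/2} / (3·(16 − t²)²). -/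
open Real intervalIntegral

/-- Volume of the quoin attached to a face `(2, 2, t)`. -/
noncomputable def quoinV (t : ℝ) : ℝ := ∫ y in (0 : ℝ)..(quoinR t), quoinA t y

/-- Slice area as a function of the slope `s` of the cutting plane and of the height `y`. -/
noncomputable def sliceArea (y s : ℝ) : ℝ :=
  (1 / 2) * (s * √((2 - y ^ 2) / (1 + s ^ 2)) - s) * (√((2 - y ^ 2) / (1 + s ^ 2)) - 1) +
    ∫ x in (s * √((2 - y ^ 2) / (1 + s ^ 2)))..(√(1 - y ^ 2)), (√(2 - x ^ 2 - y ^ 2) - 1)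

lemma hasDerivAt_sliceArea {y : ℝ} (hy : y ^ 2 < 2) (s : ℝ) :
    HasDerivAt (sliceArea y) (1 / 2 - (2 - y ^ 2) / 2 * (1 / (1 + s ^ 2))) s := by
  have hs : 0 < 1 + s ^ 2 := by positivity
  have hq : 0 < (2 - y ^ 2) / (1 + s ^ 2) := div_pos (by linarith) hs
  obtain ⟨u', hu⟩ : ∃ u', HasDerivAt (fun s : ℝ => √((2 - y ^ 2) / (1 + s ^ 2))) u' s := by
    have h1 : HasDerivAt (fun s : ℝ => 1 + s ^ 2) _ s := (hasDerivAt_pow 2 s).const_add 1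
    exact ⟨_, ((hasDerivAt_const s (2 - y ^ 2)).div h1 hs.ne').sqrt hq.ne'⟩
  have hcont : Continuous fun x : ℝ => √(2 - x ^ 2 - y ^ 2) - 1 := by fun_prop
  have hint : HasDerivAt (fun a : ℝ => ∫ x in a..(√(1 - y ^ 2)), (√(2 - x ^ 2 - y ^ 2) - 1)) _
      (s * √((2 - y ^ 2) / (1 + s ^ 2))) :=
    integral_hasDerivAt_left (hcont.intervalIntegrable _ _)
      (hcont.stronglyMeasurableAtFilter _ _) hcont.continuousAt
  have hsu := (hasDerivAt_id' s).fun_mul hu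
  have hmain := (((hsu.fun_sub (hasDerivAt_id' s)).const_mul (1 / 2)).fun_mul
    (hu.sub_const 1)).fun_add (HasDerivAt.comp s hint hsu)
  refine HasDerivAt.congr_deriv hmain ?_
  have husq : √((2 - y ^ 2) / (1 + s ^ 2)) ^ 2 * (1 + s ^ 2) = 2 - y ^ 2 := by
    rw [sq_sqrt hq.le, div_mul_cancel₀ _ hs.ne']
  have hu0 := sqrt_nonneg ((2 - y ^ 2) / (1 + s ^ 2))
  generalize √((2 - y ^ 2) / (1 + s ^ 2)) = u at *
  have hroot : √(2 - (s * u) ^ 2 - y ^ 2) = u := by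
    rw [show 2 - (s * u) ^ 2 - y ^ 2 = u ^ 2 by linear_combination -husq, sqrt_sq hu0]
  rw [hroot, ← husq]
  field_simp
  ring

lemma sliceArea_eq {y : ℝ} (hy : y ^ 2 ≤ 1) (s : ℝ) :
    sliceArea y s = (2 - y ^ 2) / 2 * arctan √(1 - y ^ 2) - √(1 - y ^ 2) / 2
      - (2 - y ^ 2) / 2 * arctan s + s / 2 := by
  have hderiv : ∀ x, HasDerivAt
      (fun x => sliceArea y x + (2 - y ^ 2) / 2 * arctan x - x / 2) 0 x := fun x => by
    refine (((hasDerivAt_sliceArea (by linarith) x).fun_add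
      ((hasDerivAt_arctan x).const_mul _)).fun_sub
      ((hasDerivAt_id' x).div_const 2)).congr_deriv ?_
    ring
  have hconst := is_const_of_deriv_eq_zero (fun x => (hderiv x).differentiableAt)
    (fun x => (hderiv x).deriv) s √(1 - y ^ 2)
  have hzero : sliceArea y √(1 - y ^ 2) = 0 := by
    have h : (2 - y ^ 2) / (1 + √(1 - y ^ 2) ^ 2) = 1 := by
      rw [sq_sqrt (by linarith), div_eq_one_iff_eq (by linarith)]
      ring
    simp [sliceArea, h]
  simp only [hzero] at hconst
  linarith

/-- Volume of the quoin as a function of the slope `s` of the cutting plane. -/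
noncomputable def quoinVolume (s : ℝ) : ℝ :=
  (∫ y in (0 : ℝ)..√(1 - s ^ 2), ((2 - y ^ 2) / 2 * arctan √(1 - y ^ 2) - √(1 - y ^ 2) / 2))
    - arctan s * (√(1 - s ^ 2) - √(1 - s ^ 2) ^ 3 / 6) + s / 2 * √(1 - s ^ 2)

lemma quoinR_eq {t : ℝ} (ht : t ^ 2 < 8) : quoinR t = √(1 - quoinS t ^ 2) := by
  have h : 16 - t ^ 2 ≠ 0 := by linarith
  rw [quoinR, quoinS, div_pow, sq_sqrt (by linarith)]
  congr 1
  field_simp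
  ring

lemma quoinV_eq {t : ℝ} (ht : t ^ 2 < 8) : quoinV t = quoinVolume (quoinS t) := by
  have hA : Set.EqOn (quoinA t) (fun y => ((2 - y ^ 2) / 2 * arctan √(1 - y ^ 2)
      - √(1 - y ^ 2) / 2) - (1 - y ^ 2 / 2) * arctan (quoinS t) + quoinS t / 2)
      (Set.uIcc 0 (√(1 - quoinS t ^ 2))) := fun y hy => by
    rw [Set.uIcc_of_le (sqrt_nonneg _)] at hy
    have hy1 : y ≤ 1 := hy.2.trans (sqrt_le_one.2 (by nlinarith [sq_nonneg (quoinS t)]))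
    have h := sliceArea_eq (show y ^ 2 ≤ 1 by nlinarith [hy.1]) (quoinS t)
    have h' : quoinA t y = sliceArea y (quoinS t) := rfl
    rw [h', h]
    ring
  rw [quoinV, quoinR_eq ht, integral_congr hA, quoinVolume]
  have hint : ∀ f : ℝ → ℝ, Continuous f →
      IntervalIntegrable f MeasureTheory.volume 0 √(1 - quoinS t ^ 2) :=
    fun f hf => hf.intervalIntegrable _ _
  rw [integral_add (hint _ (by fun_prop)) (hint _ (by fun_prop)),
    integral_sub (hint _ (by fun_prop)) (hint _ (by fun_prop)), integral_mul_const,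
    integral_sub (f := fun _ => (1 : ℝ)) (hint _ (by fun_prop)) (hint _ (by fun_prop)),
    integral_div 2 (fun y : ℝ => y ^ 2), integral_pow]
  simp only [integral_const, smul_eq_mul]
  push_cast
  ring

lemma hasDerivAt_quoinVolume {s : ℝ} (hs0 : 0 ≤ s) (hs1 : s ^ 2 < 1) :
    HasDerivAt quoinVolume (-√(1 - s ^ 2) ^ 3 / (3 * (1 + s ^ 2))) s := by
  have hs : 1 + s ^ 2 ≠ 0 := by positivity
  obtain ⟨r', hr⟩ : ∃ r', HasDerivAt (fun s : ℝ => √(1 - s ^ 2)) r' s :=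
    ⟨_, ((hasDerivAt_pow 2 s).const_sub 1).sqrt (by linarith)⟩
  have hcont : Continuous fun y : ℝ =>
      (2 - y ^ 2) / 2 * arctan √(1 - y ^ 2) - √(1 - y ^ 2) / 2 := by fun_prop
  have hint : HasDerivAt (fun b : ℝ => ∫ y in (0 : ℝ)..b,
      ((2 - y ^ 2) / 2 * arctan √(1 - y ^ 2) - √(1 - y ^ 2) / 2)) _ √(1 - s ^ 2) :=
    integral_hasDerivAt_right (hcont.intervalIntegrable _ _)
      (hcont.stronglyMeasurableAtFilter _ _) hcont.continuousAt
  have hmain := ((HasDerivAt.comp s hint hr).fun_sub ((hasDerivAt_arctan s).fun_mul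
    (hr.fun_sub ((hr.fun_pow 3).div_const 6)))).fun_add
    (((hasDerivAt_id' s).div_const 2).fun_mul hr)
  refine HasDerivAt.congr_deriv hmain ?_
  have hrsq : √(1 - s ^ 2) ^ 2 = 1 - s ^ 2 := sq_sqrt (by linarith)
  generalize √(1 - s ^ 2) = r at *
  have hroot : √(1 - r ^ 2) = s := by rw [hrsq, sub_sub_cancel, sqrt_sq hs0]
  rw [hroot]
  have hs2 : s ^ 2 = 1 - r ^ 2 := by linarith
  rw [hs2] at hs ⊢
  push_cast
  field_simp
  ring

lemma hasDerivAt_quoinS {t : ℝ} (ht : t ^ 2 < 16) :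
    HasDerivAt quoinS (16 / √(16 - t ^ 2) ^ 3) t := by
  have h0 : 0 < 16 - t ^ 2 := by linarith
  have hq : √(16 - t ^ 2) ≠ 0 := (sqrt_pos.2 h0).ne'
  have hmain := (hasDerivAt_id' t).fun_div
    (((hasDerivAt_pow 2 t).const_sub 16).sqrt h0.ne') hq
  refine HasDerivAt.congr_deriv hmain ?_
  have hsq : √(16 - t ^ 2) ^ 2 = 16 - t ^ 2 := sq_sqrt h0.le
  generalize √(16 - t ^ 2) = q at *
  field_simp
  push_cast
  linear_combination 2 * hsq

theorem quoin_volume_deriv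
    (t : ℝ) (ht : t ∈ Set.Ioo (4 / 2.51) 2.51) :
    HasDerivAt quoinV
      (-2 * Real.sqrt 2 * (8 - t ^ 2) ^ ((3 : ℝ) / 2) / (3 * (16 - t ^ 2) ^ 2)) t := by
  have h0 : 0 ≤ t := by
    have := ht.1
    norm_num at this
    linarith
  have h8 : t ^ 2 < 8 := by
    have := ht.2
    norm_num at this
    nlinarith
  have hS0 : 0 ≤ quoinS t := div_nonneg h0 (sqrt_nonneg _)
  have hS2 : quoinS t ^ 2 = t ^ 2 / (16 - t ^ 2) := by
    rw [quoinS, div_pow, sq_sqrt (by linarith)]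
  have hS1 : quoinS t ^ 2 < 1 := by
    rw [hS2, div_lt_one (by linarith)]
    linarith
  have hev : quoinV =ᶠ[nhds t] quoinVolume ∘ quoinS := by
    filter_upwards [(continuous_pow 2).continuousAt.eventually_lt continuousAt_const h8]
      with x hx using quoinV_eq hx
  refine ((HasDerivAt.comp t (hasDerivAt_quoinVolume hS0 hS1)
    (hasDerivAt_quoinS (by linarith))).congr_of_eventuallyEq hev).congr_deriv ?_
  have hp : (8 - t ^ 2) ^ ((3 : ℝ) / 2) = √(8 - t ^ 2) ^ 3 := by
    rw [sqrt_eq_rpow, ← rpow_mul_natCast (by linarith)]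
    norm_num
  have hr : √(1 - quoinS t ^ 2) = √2 * √(8 - t ^ 2) / √(16 - t ^ 2) := by
    rw [← quoinR_eq h8, quoinR, ← sqrt_mul (by norm_num), ← sqrt_div' _ (by linarith)]
    ring_nf
  have hq : √(16 - t ^ 2) ^ 2 = 16 - t ^ 2 := sq_sqrt (by linarith)
  have hq0 : √(16 - t ^ 2) ≠ 0 := (sqrt_pos.2 (by linarith)).ne'
  have hS : 1 + quoinS t ^ 2 = 16 / √(16 - t ^ 2) ^ 2 := by
    rw [hS2, hq]
    have : 16 - t ^ 2 ≠ 0 := by linarith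
    field_simp
    ring
  rw [hp, hr, hS]
  generalize √(16 - t ^ 2) = q at *
  rw [← hq]
  have h2 : √(2 : ℝ) ^ 2 = 2 := sq_sqrt (by norm_num)
  field_simp
  rw [h2]
  ring
end

section
/- Define g₁(x₁, x₂) = (16 − x₁)·x₁·(8 − x₂)·(b − x₁ + x₂) and p₁(x₁, x₂, b) = 128b − 128x₁ − 128x₂ − 8b·x₁ − 8b·x₂ + 8x₁² + 8x₂² + 32x₁x₂ + b·x₁x₂ − x₁²x₂ − x₁x₂². Then (x₁ − x₂)·p₁(x₁, x₂, b) = g₁(x₁, x₂) − g₁(x₂, x₁) for all reals, and p₁(x₁, x₂, b) > 0 for all x₁, x₂ ∈ [16/2.51², 2.51²] and b ∈ [8, 2·2.51²]. -/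
/-- The first factor of `g` in the quoin perturbation argument. -/
noncomputable def g₁ (b x₁ x₂ : ℝ) : ℝ := (16 - x₁) * x₁ * (8 - x₂) * (b - x₁ + x₂)

/-- The symmetrized difference quotient of `g₁`. -/
noncomputable def p₁ (x₁ x₂ b : ℝ) : ℝ :=
  128 * b - 128 * x₁ - 128 * x₂ - 8 * b * x₁ - 8 * b * x₂ + 8 * x₁ ^ 2 + 8 * x₂ ^ 2
    + 32 * x₁ * x₂ + b * x₁ * x₂ - x₁ ^ 2 * x₂ - x₁ * x₂ ^ 2

theorem p₁_identity_and_positive :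
    (∀ x₁ x₂ b : ℝ, (x₁ - x₂) * p₁ x₁ x₂ b = g₁ b x₁ x₂ - g₁ b x₂ x₁) ∧
    (∀ x₁ x₂ b : ℝ, x₁ ∈ Set.Icc (16 / 2.51 ^ 2) (2.51 ^ 2) →
      x₂ ∈ Set.Icc (16 / 2.51 ^ 2) (2.51 ^ 2) →
      b ∈ Set.Icc 8 (2 * 2.51 ^ 2) → 0 < p₁ x₁ x₂ b) := by
  refine ⟨fun x₁ x₂ b => by unfold p₁ g₁; ring, fun x₁ x₂ b hx₁ hx₂ hb => ?_⟩
  have l₁ : 5 / 2 ≤ x₁ := le_trans (by norm_num) hx₁.1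
  have l₂ : 5 / 2 ≤ x₂ := le_trans (by norm_num) hx₂.1
  have u₁ : x₁ ≤ 6.4 := hx₁.2.trans (by norm_num)
  have u₂ : x₂ ≤ 6.4 := hx₂.2.trans (by norm_num)
  have coeff_pos : 0 ≤ (b - 8) * ((8 - x₁) * (8 - x₂) + 64) :=
    mul_nonneg (sub_nonneg.2 hb.1)
      (add_nonneg (mul_nonneg (by linarith) (by linarith)) (by norm_num))
  have prod_bound : 0 ≤ (x₁ - 5 / 2) * (x₂ - 5 / 2) * (24 - (x₁ + x₂)) :=
    mul_nonneg (mul_nonneg (by linarith) (by linarith)) (by linarith)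
  have key : p₁ x₁ x₂ b = (b - 8) * ((8 - x₁) * (8 - x₂) + 64)
      + (x₁ - 5 / 2) * (x₂ - 5 / 2) * (24 - (x₁ + x₂))
      + (8 * (x₁ + x₂ - 8) * (x₁ + x₂ - 16)
        + (5 / 2 * (x₁ + x₂) - 25 / 4) * (24 - (x₁ + x₂))) := by
    unfold p₁; ring
  have base_pos : 0 < 8 * (x₁ + x₂ - 8) * (x₁ + x₂ - 16)
      + (5 / 2 * (x₁ + x₂) - 25 / 4) * (24 - (x₁ + x₂)) := by
    nlinarith [sq_nonneg (x₁ + x₂ - 12)]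
  linarith
end

section
/- Define g₂(x₁, x₂) = (16 − x₁)·(8 − x₂)²·(b − x₁ + x₂) and p₂(x₁, x₂, b) = −2048 + 192b + 320x₁ − 16b·x₁ − 16x₁² + 320x₂ − 16b·x₂ − 32x₁x₂ + b·x₁x₂ + x₁²x₂ − 16x₂² + x₁x₂². Then (x₁ − x₂)·p₂(x₁, x₂, b) = g₂(x₁, x₂) − g₂(x₂, x₁) for all reals, and p₂(x₁, x₂, b) > 0 for all x₁, x₂ ∈ [16/2.51², 2.51²] and b ∈ [8, 2·2.51²]. -/
/-- The second factor of `g` in the quoin perturbation argument. -/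
noncomputable def g₂ (b x₁ x₂ : ℝ) : ℝ := (16 - x₁) * (8 - x₂) ^ 2 * (b - x₁ + x₂)

/-- The symmetrized difference quotient of `g₂`. -/
noncomputable def p₂ (x₁ x₂ b : ℝ) : ℝ :=
  -2048 + 192 * b + 320 * x₁ - 16 * b * x₁ - 16 * x₁ ^ 2 + 320 * x₂ - 16 * b * x₂
    - 32 * x₁ * x₂ + b * x₁ * x₂ + x₁ ^ 2 * x₂ - 16 * x₂ ^ 2 + x₁ * x₂ ^ 2

theorem p₂_identity_and_positive :
    (∀ x₁ x₂ b : ℝ, (x₁ - x₂) * p₂ x₁ x₂ b = g₂ b x₁ x₂ - g₂ b x₂ x₁) ∧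
    (∀ x₁ x₂ b : ℝ, x₁ ∈ Set.Icc (16 / 2.51 ^ 2) (2.51 ^ 2) →
      x₂ ∈ Set.Icc (16 / 2.51 ^ 2) (2.51 ^ 2) →
      b ∈ Set.Icc 8 (2 * 2.51 ^ 2) → 0 < p₂ x₁ x₂ b) := by
  refine ⟨fun x₁ x₂ b => by unfold p₂ g₂; ring, ?_⟩
  rintro x₁ x₂ b ⟨hl₁, hu₁⟩ ⟨hl₂, hu₂⟩ ⟨hb, -⟩
  have hm : (2.53 : ℝ) ≤ 16 / 2.51 ^ 2 := by norm_num
  have hM : (2.51 : ℝ) ^ 2 ≤ 6.31 := by norm_num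
  have hl₁ := hm.trans hl₁
  have hl₂ := hm.trans hl₂
  have hu₁ := hu₁.trans hM
  have hu₂ := hu₂.trans hM
  have hcoeff : 0 ≤ 192 - 16 * x₁ - 16 * x₂ + x₁ * x₂ := by
    nlinarith [mul_nonneg (sub_nonneg.2 hu₁) (sub_nonneg.2 hu₂)]
  have hsplit : p₂ x₁ x₂ b = (b - 8) * (192 - 16 * x₁ - 16 * x₂ + x₁ * x₂) +
      (-512 + 192 * (x₁ + x₂) - 16 * (x₁ + x₂) ^ 2 + (8 + (x₁ + x₂)) * (x₁ * x₂)) := by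
    unfold p₂; ring
  have hlow : x₁ * x₂ ≥ 2.53 * (x₁ + x₂) - 2.53 ^ 2 := by
    nlinarith [mul_nonneg (sub_nonneg.2 hl₁) (sub_nonneg.2 hl₂)]
  have hhigh : x₁ * x₂ ≥ 6.31 * (x₁ + x₂) - 6.31 ^ 2 := by
    nlinarith [mul_nonneg (sub_nonneg.2 hu₁) (sub_nonneg.2 hu₂)]
  have hs_low : 5.06 ≤ x₁ + x₂ := by linarith
  have hs_high : x₁ + x₂ ≤ 12.62 := by linarith
  rw [hsplit]
  refine add_pos_of_nonneg_of_pos (mul_nonneg (sub_nonneg.2 hb) hcoeff) ?_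
  generalize x₁ + x₂ = s at *
  generalize x₁ * x₂ = q at *
  have hs : 0 ≤ 8 + s := by linarith
  rcases le_total s 8.84 with h | h
  · nlinarith [mul_le_mul_of_nonneg_left hlow hs,
      mul_nonneg (sub_nonneg.2 hs_low) (sub_nonneg.2 h)]
  · nlinarith [mul_le_mul_of_nonneg_left hhigh hs,
      mul_nonneg (sub_nonneg.2 h) (sub_nonneg.2 hs_high)]
end

section
/- Let b ∈ [8, 2·2.51²] and let x₁, x₂ ∈ [16/2.51², 2.51²] with x₁ < x₂. Define g₁(x₁, x₂) = (16 − x₁)·x₁·(8 − x₂)·(b − x₁ + x₂) and g₂(x₁, x₂) = (16 − x₁)·(8 − x₂)²·(b − x₁ + x₂). Then g₁(x₁, x₂) < g₁(x₂, x₁) and g₂(x₁, x₂) < g₂(x₂, x₁). -/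
theorem g₁_sub_swap (b x y : ℝ) :
    g₁ b y x - g₁ b x y = (y - x) * (b * (128 - 8 * (x + y) + x * y) -
      (128 * (x + y) - 16 * (x * y) - 8 * (x + y) ^ 2 + x * y * (x + y))) := by
  unfold g₁
  ring

theorem g₂_sub_swap (b x y : ℝ) :
    g₂ b y x - g₂ b x y = (y - x) * (b * (8 * ((8 - x) + (8 - y)) + (8 - x) * (8 - y)) -
      8 * ((8 - x) + (8 - y)) ^ 2 + 16 * ((8 - x) * (8 - y)) -
        (8 - x) * (8 - y) * ((8 - x) + (8 - y))) := by
  unfold g₂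
  ring

theorem g₁_lt_swap {b x y : ℝ} (hb : 8 ≤ b) (hy : y ≤ 6.31) (hxy : x < y) :
    g₁ b x y < g₁ b y x := by
  rw [← sub_pos, g₁_sub_swap]
  apply mul_pos (sub_pos.2 hxy)
  have huv : 0 ≤ (8 - x) * (8 - y) := mul_nonneg (by linarith) (by linarith)
  have hbase : 8 * (128 - 8 * (x + y) + x * y) ≤ b * (128 - 8 * (x + y) + x * y) :=
    mul_le_mul_of_nonneg_right hb (by linarith)
  have hp : 0 ≤ (6.31 - x) * (6.31 - y) * (24 - (x + y)) :=
    mul_nonneg (mul_nonneg (by linarith) (by linarith)) (by linarith)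
  nlinarith [sq_nonneg (x + y)]

theorem g₂_lt_swap {b x y : ℝ} (hb : 8 ≤ b) (hx : 2.53 ≤ x)
    (hy : y < 8) (hxy : x < y) :
    g₂ b x y < g₂ b y x := by
  rw [← sub_pos, g₂_sub_swap]
  apply mul_pos (sub_pos.2 hxy)
  obtain ⟨u, rfl⟩ : ∃ u, x = 8 - u := ⟨8 - x, by ring⟩
  obtain ⟨v, rfl⟩ : ∃ v, y = 8 - v := ⟨8 - y, by ring⟩
  simp only [sub_sub_cancel]
  have hu : 0 ≤ u := by linarith
  have hv : 0 < v := by linarith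
  have huv : 0 ≤ u * v := mul_nonneg hu hv.le
  have hbase : 8 * (8 * (u + v) + u * v) ≤ b * (8 * (u + v) + u * v) :=
    mul_le_mul_of_nonneg_right hb (by linarith)
  suffices 0 < 8 * (u + v) * (8 - (u + v)) + u * v * (24 - (u + v)) by nlinarith
  rcases lt_or_ge (u + v) 8 with hs | hs
  · have h₁ : 0 < 8 * (u + v) * (8 - (u + v)) := mul_pos (by linarith) (by linarith)
    have h₂ : 0 ≤ u * v * (24 - (u + v)) := mul_nonneg huv (by linarith)
    linarith
  · have hq : 0 ≤ (5.47 - u) * (5.47 - v) * (24 - (u + v)) :=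
      mul_nonneg (mul_nonneg (by linarith) (by linarith)) (by linarith)
    have hs' : 0 ≤ (u + v - 8) * (10.94 - (u + v)) := mul_nonneg (by linarith) (by linarith)
    nlinarith

theorem g₁_g₂_monotonicity
    (b x₁ x₂ : ℝ) (hb : b ∈ Set.Icc 8 (2 * 2.51 ^ 2))
    (hx₁ : x₁ ∈ Set.Icc (16 / 2.51 ^ 2) (2.51 ^ 2))
    (hx₂ : x₂ ∈ Set.Icc (16 / 2.51 ^ 2) (2.51 ^ 2))
    (hlt : x₁ < x₂) :
    g₁ b x₁ x₂ < g₁ b x₂ x₁ ∧ g₂ b x₁ x₂ < g₂ b x₂ x₁ := by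
  have hlo : (2.53 : ℝ) ≤ 16 / 2.51 ^ 2 := by norm_num
  have hhi : (2.51 : ℝ) ^ 2 ≤ 6.31 := by norm_num
  exact ⟨g₁_lt_swap hb.1 (hx₂.2.trans hhi) hlt,
    g₂_lt_swap hb.1 (hlo.trans hx₁.1) (by linarith [hx₂.2]) hlt⟩
end

section
/- Let b ∈ [8, 2·2.51²] and let x₁, x₂ ∈ [16/2.51², 2.51²] with x₁ < x₂. Then (16 − x₁)²·x₁·(8 − x₂)³·(b − x₁ + x₂)² < (16 − x₂)²·x₂·(8 − x₁)³·(b + x₁ − x₂)². -/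
/-- Writing `x = 4 + k - u` and `y = 4 + k + u`, the two sides at diagonal `8` differ by
a nonnegative multiple of `k ^ 2 * u`. -/
theorem mul_mul_sq_le_of_diag_eight {x y : ℝ} (hxy : x ≤ y) :
    x * (8 - y) * (8 - x + y) ^ 2 ≤ y * (8 - x) * (8 + x - y) ^ 2 := by
  have h : 0 ≤ (y - x) * (x + y - 8) ^ 2 := mul_nonneg (sub_nonneg.2 hxy) (sq_nonneg _)
  linear_combination 8 * h

theorem mul_mul_sq_le_of_eight_le {b x y : ℝ} (hb : 8 ≤ b) (hx : 0 ≤ x) (hxy : x ≤ y)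
    (hy : y ≤ 8) :
    x * (8 - y) * (b - x + y) ^ 2 ≤ y * (8 - x) * (b + x - y) ^ 2 := by
  have hcross : (b - x + y) * (8 + x - y) ≤ (8 - x + y) * (b + x - y) := by
    linear_combination 2 * mul_nonneg (sub_nonneg.2 hb) (sub_nonneg.2 hxy)
  by_cases hdeg : 8 + x - y = 0
  · have hx0 : x = 0 := by linarith
    have hy8 : y = 8 := by linarith
    subst hx0 hy8
    simp only [zero_mul]
    positivity
  have hpos : 0 < 8 + x - y := lt_of_le_of_ne (by linarith) (Ne.symm hdeg)
  have hxy8 : 0 ≤ x * (8 - y) := mul_nonneg hx (by linarith)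
  refine le_of_mul_le_mul_right ?_ (pow_pos hpos 2)
  calc x * (8 - y) * (b - x + y) ^ 2 * (8 + x - y) ^ 2
      = x * (8 - y) * ((b - x + y) * (8 + x - y)) ^ 2 := by ring
    _ ≤ x * (8 - y) * ((8 - x + y) * (b + x - y)) ^ 2 := by
        have : 0 ≤ (b - x + y) * (8 + x - y) := mul_nonneg (by linarith) hpos.le
        gcongr
    _ = x * (8 - y) * (8 - x + y) ^ 2 * (b + x - y) ^ 2 := by ring
    _ ≤ y * (8 - x) * (8 + x - y) ^ 2 * (b + x - y) ^ 2 :=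
        mul_le_mul_of_nonneg_right (mul_mul_sq_le_of_diag_eight hxy) (sq_nonneg _)
    _ = y * (8 - x) * (b + x - y) ^ 2 * (8 + x - y) ^ 2 := by ring

theorem g_monotonicity
    (b x₁ x₂ : ℝ) (hb : b ∈ Set.Icc 8 (2 * 2.51 ^ 2))
    (hx₁ : x₁ ∈ Set.Icc (16 / 2.51 ^ 2) (2.51 ^ 2))
    (hx₂ : x₂ ∈ Set.Icc (16 / 2.51 ^ 2) (2.51 ^ 2))
    (hlt : x₁ < x₂) :
    (16 - x₁) ^ 2 * x₁ * (8 - x₂) ^ 3 * (b - x₁ + x₂) ^ 2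
      < (16 - x₂) ^ 2 * x₂ * (8 - x₁) ^ 3 * (b + x₁ - x₂) ^ 2 := by
  have hb8 : 8 ≤ b := hb.1
  have hpos : 0 < x₁ := lt_of_lt_of_le (by norm_num) hx₁.1
  have hlt8 : x₂ < 8 := lt_of_le_of_lt hx₂.2 (by norm_num)
  have hfactor : 0 < x₁ * (8 - x₂) * (b - x₁ + x₂) ^ 2 :=
    mul_pos (mul_pos hpos (by linarith)) (pow_pos (by linarith) 2)
  have hsq : ((16 - x₁) * (8 - x₂)) ^ 2 < ((16 - x₂) * (8 - x₁)) ^ 2 :=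
    pow_lt_pow_left₀ (by linarith) (mul_nonneg (by linarith) (by linarith)) two_ne_zero
  calc (16 - x₁) ^ 2 * x₁ * (8 - x₂) ^ 3 * (b - x₁ + x₂) ^ 2
      = ((16 - x₁) * (8 - x₂)) ^ 2 * (x₁ * (8 - x₂) * (b - x₁ + x₂) ^ 2) := by ring
    _ < ((16 - x₂) * (8 - x₁)) ^ 2 * (x₁ * (8 - x₂) * (b - x₁ + x₂) ^ 2) :=
        mul_lt_mul_of_pos_right hsq hfactor
    _ ≤ ((16 - x₂) * (8 - x₁)) ^ 2 * (x₂ * (8 - x₁) * (b + x₁ - x₂) ^ 2) :=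
        mul_le_mul_of_nonneg_left
          (mul_mul_sq_le_of_eight_le hb8 hpos.le hlt.le hlt8.le) (sq_nonneg _)
    _ = (16 - x₂) ^ 2 * x₂ * (8 - x₁) ^ 3 * (b + x₁ - x₂) ^ 2 := by ring
end

section
/- Let b ∈ [8, 2·2.51²] and let y₁, y₂ ∈ [4/2.51, 2.51] with y₁ < y₂; set x₁ = y₁² and x₂ = y₂². Then −(8 − x₁)^{3/2}·(16 − x₂)·y₂·(x₁ + b − x₂) + (8 − x₂)^{3/2}·(16 − x₁)·y₁·(x₂ + b − x₁) < 0. -/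
private lemma cubic_ratio_lt {s t : ℝ} (hs : 2.539 ≤ s) (hst : s < t) (h8 : s + t ≤ 8) :
    (8 - t) ^ 3 * (16 - s) ^ 2 * t < (8 - s) ^ 3 * (16 - t) ^ 2 * s := by
  obtain ⟨a, rfl⟩ : ∃ a, s = 8 - a := ⟨8 - s, by ring⟩
  obtain ⟨c, rfl⟩ : ∃ c, t = 8 - c := ⟨8 - t, by ring⟩
  have ha : a ≤ 5461 / 1000 := by norm_num at hs; linarith
  have hquot : 0 < 512 * (a + c) ^ 2 - 64 * (a + c) ^ 3
      + a * c * (256 * (a + c) - 16 * (a + c) ^ 2 - 512) + (a * c) ^ 2 * (24 - (a + c)) := by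
    have hP : 5461 / 1000 * (a + c) - (5461 / 1000) ^ 2 ≤ a * c := by nlinarith
    have hS : a + c ≤ 10922 / 1000 := by linarith
    have hS8 : 8 ≤ a + c := by linarith
    generalize a * c = P at *
    generalize a + c = S at *
    have hP0 : 0 ≤ 5461 / 1000 * S - (5461 / 1000) ^ 2 := by linarith
    have hcoef : 0 ≤ 256 * S - 16 * S ^ 2 - 512 := by nlinarith
    have h24 : 0 ≤ 24 - S := by linarith
    have hmin : 0 < 512 * S ^ 2 - 64 * S ^ 3
        + (5461 / 1000 * S - (5461 / 1000) ^ 2) * (256 * S - 16 * S ^ 2 - 512)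
        + (5461 / 1000 * S - (5461 / 1000) ^ 2) ^ 2 * (24 - S) := by
      nlinarith [mul_nonneg (sub_nonneg.2 hS) (sub_nonneg.2 hS8),
        mul_nonneg (mul_nonneg (sub_nonneg.2 hS) (sub_nonneg.2 hS8)) (sub_nonneg.2 hS),
        mul_nonneg (mul_nonneg (sub_nonneg.2 hS) (sub_nonneg.2 hS8)) (sub_nonneg.2 hS8)]
    refine hmin.trans_le ?_
    gcongr
  have := mul_pos (show 0 < a - c by linarith) hquot
  linarith

theorem quoin_perturbation_inequality
    (b y₁ y₂ : ℝ) (hb : b ∈ Set.Icc 8 (2 * 2.51 ^ 2))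
    (hy₁ : y₁ ∈ Set.Icc (4 / 2.51) 2.51)
    (hy₂ : y₂ ∈ Set.Icc (4 / 2.51) 2.51)
    (hlt : y₁ < y₂) :
    -(8 - y₁ ^ 2) ^ ((3 : ℝ) / 2) * (16 - y₂ ^ 2) * y₂ * (y₁ ^ 2 + b - y₂ ^ 2)
      + (8 - y₂ ^ 2) ^ ((3 : ℝ) / 2) * (16 - y₁ ^ 2) * y₁ * (y₂ ^ 2 + b - y₁ ^ 2) < 0 := by
  obtain ⟨hb, -⟩ := hb
  obtain ⟨h₁, -⟩ := hy₁
  obtain ⟨-, h₂⟩ := hy₂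
  have hy₁ : 0 < y₁ := by norm_num at h₁; linarith
  have hy₂ : 0 < y₂ := hy₁.trans hlt
  have hs : 2.539 ≤ y₁ ^ 2 := by
    have := pow_le_pow_left₀ (by norm_num) h₁ 2
    norm_num at this ⊢
    linarith
  have ht : y₂ ^ 2 ≤ 6.3001 := by
    have := pow_le_pow_left₀ hy₂.le h₂ 2
    norm_num at this ⊢
    linarith
  have hst : y₁ ^ 2 < y₂ ^ 2 := by gcongr
  have hpow : ∀ x : ℝ, 0 ≤ x → (x ^ ((3 : ℝ) / 2)) ^ 2 = x ^ 3 := fun x hx ↦ by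
    rw [← Real.rpow_mul_natCast hx, ← Real.rpow_natCast]
    norm_num
  norm_num at hs ht
  have hp := Real.rpow_pos_of_pos (show 0 < 8 - y₁ ^ 2 by linarith) (3 / 2)
  have hq := Real.rpow_pos_of_pos (show 0 < 8 - y₂ ^ 2 by linarith) (3 / 2)
  have hp2 := hpow (8 - y₁ ^ 2) (by linarith)
  have hq2 := hpow (8 - y₂ ^ 2) (by linarith)
  generalize (8 - y₁ ^ 2) ^ ((3 : ℝ) / 2) = p at *
  generalize (8 - y₂ ^ 2) ^ ((3 : ℝ) / 2) = q at *
  have key : ∀ l m : ℝ, 0 < l → 0 < m →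
      (y₂ ^ 2 + b - y₁ ^ 2) * l ≤ (y₁ ^ 2 + b - y₂ ^ 2) * m →
      (8 - y₂ ^ 2) ^ 3 * (16 - y₁ ^ 2) ^ 2 * y₁ ^ 2 * m ^ 2 <
        (8 - y₁ ^ 2) ^ 3 * (16 - y₂ ^ 2) ^ 2 * y₂ ^ 2 * l ^ 2 →
      q * (16 - y₁ ^ 2) * y₁ * (y₂ ^ 2 + b - y₁ ^ 2) <
        p * (16 - y₂ ^ 2) * y₂ * (y₁ ^ 2 + b - y₂ ^ 2) := by
    intro l m hl hm hlm hsq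
    have h16s : 0 < 16 - y₁ ^ 2 := by linarith
    have h16t : 0 < 16 - y₂ ^ 2 := by linarith
    have hroot : q * (16 - y₁ ^ 2) * y₁ * m < p * (16 - y₂ ^ 2) * y₂ * l := by
      refine lt_of_pow_lt_pow_left₀ 2 (by positivity) ?_
      simpa only [mul_pow, hp2, hq2] using hsq
    have hbδ : 0 < y₁ ^ 2 + b - y₂ ^ 2 := by linarith
    refine lt_of_mul_lt_mul_right ?_ hl.le
    calc q * (16 - y₁ ^ 2) * y₁ * (y₂ ^ 2 + b - y₁ ^ 2) * l
        = q * (16 - y₁ ^ 2) * y₁ * ((y₂ ^ 2 + b - y₁ ^ 2) * l) := by ring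
      _ ≤ q * (16 - y₁ ^ 2) * y₁ * ((y₁ ^ 2 + b - y₂ ^ 2) * m) := by gcongr
      _ = q * (16 - y₁ ^ 2) * y₁ * m * (y₁ ^ 2 + b - y₂ ^ 2) := by ring
      _ < p * (16 - y₂ ^ 2) * y₂ * l * (y₁ ^ 2 + b - y₂ ^ 2) := by gcongr
      _ = _ := by ring
  suffices q * (16 - y₁ ^ 2) * y₁ * (y₂ ^ 2 + b - y₁ ^ 2) <
      p * (16 - y₂ ^ 2) * y₂ * (y₁ ^ 2 + b - y₂ ^ 2) by linarith
  clear hpow hp2 hq2 h₁ h₂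
  have hs0 : 0 < y₁ ^ 2 := by positivity
  rcases le_total (y₁ ^ 2 + y₂ ^ 2) 8 with h8 | h8
  · refine key (y₁ ^ 2) (y₂ ^ 2) (by positivity) (by positivity) ?_ ?_
    · nlinarith
    · have h := cubic_ratio_lt (by norm_num; linarith) hst h8
      have := mul_lt_mul_of_pos_right h (show 0 < y₁ ^ 2 * y₂ ^ 2 by positivity)
      linarith
  · refine key (8 - y₂ ^ 2) (8 - y₁ ^ 2) (by linarith) (by linarith) ?_ ?_
    · nlinarith
    · generalize y₁ ^ 2 = s at *
      generalize y₂ ^ 2 = t at *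
      have hA : (8 - t) * (16 - s) < (8 - s) * (16 - t) := by linarith
      have hB : (16 - s) * s < (16 - t) * t := by nlinarith
      have hC := mul_lt_mul'' hA hB (mul_nonneg (by linarith) (by linarith))
        (mul_nonneg (by linarith) hs0.le)
      have hD : 0 < (8 - s) ^ 2 * (8 - t) ^ 2 :=
        mul_pos (pow_pos (by linarith) 2) (pow_pos (by linarith) 2)
      have := mul_lt_mul_of_pos_right hC hD
      linarith
end
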